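/- For n ≥ 3, the (a,b)-weighted enumeration of non-occupied corners of type (a,b) in tree-like tableaux of size n satisfies ∑_{noc ∈ NOC_{a,b}(T_n)} w(noc) = (n−2)·ab·T_{n−2}(a,b), where T_m(a,b) = (a+b)(a+b+1)···(a+b+m−2). -/

import Mathlib

open Finset

/-- `D` is a Young-diagram-shaped finite set of cells (cell `(i,j)` is in row `i`, column `j`,
indexed from the top-left corner `(0,0)`). -/
def IsYoung (D : Finset (ℕ × ℕ)) : Prop :=
  ∀ i j i' j', (i, j) ∈ D → i' ≤ i → j' ≤ j → (i', j') ∈ D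

/-- `(D, P)` is a tree-like tableau: `D` is the Young-diagram shape and `P ⊆ D` is the
set of pointed cells.  The top-left cell is pointed (root point); every non-root
point has a point above it in its column or a point to its left in its row, but not both;
every row and every column of `D` contains a point. -/
def IsTLT (D P : Finset (ℕ × ℕ)) : Prop :=
  IsYoung D ∧ P ⊆ D ∧ (0, 0) ∈ P ∧
  (∀ c ∈ P, c ≠ (0, 0) →
    ((∃ r < c.1, (r, c.2) ∈ P) ↔ ¬ (∃ k < c.2, (c.1, k) ∈ P))) ∧
  (∀ c ∈ D, (∃ k, (c.1, k) ∈ P) ∧ (∃ r, (r, c.2) ∈ P))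

/-- A corner of the diagram `D`: a cell whose bottom and right edges are border edges. -/
def CornerCell (D : Finset (ℕ × ℕ)) (c : ℕ × ℕ) : Prop :=
  c ∈ D ∧ (c.1 + 1, c.2) ∉ D ∧ (c.1, c.2 + 1) ∉ D

open scoped Classical in
/-- The (finite) set of tree-like tableaux of size `n`; any such tableau has at most `n`
rows and `n` columns, hence fits inside the `(n+1) × (n+1)` grid. -/
noncomputable def TLTs (n : ℕ) : Finset (Finset (ℕ × ℕ) × Finset (ℕ × ℕ)) :=
  ((Finset.range (n + 1) ×ˢ Finset.range (n + 1)).powerset ×ˢ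
      (Finset.range (n + 1) ×ˢ Finset.range (n + 1)).powerset).filter
    (fun T => IsTLT T.1 T.2 ∧ T.2.card = n)


/-- Number of non-root points in the first row of the tableau `(D, P)`. -/
noncomputable def topStat (P : Finset (ℕ × ℕ)) : ℕ :=
  (P.filter (fun c => c.1 = 0 ∧ c ≠ (0, 0))).card

/-- Number of non-root points in the first column of the tableau `(D, P)`. -/
noncomputable def leftStat (P : Finset (ℕ × ℕ)) : ℕ :=
  (P.filter (fun c => c.2 = 0 ∧ c ≠ (0, 0))).card

/-- `c` is a non-occupied corner of `(D, P)` of type `(a,b)`: it has no point above it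
in its column except in the first row, and no point to its left in its row except in
the first column. -/
def NocAB (D P : Finset (ℕ × ℕ)) (c : ℕ × ℕ) : Prop :=
  CornerCell D c ∧ c ∉ P ∧
  (∀ r, 0 < r → r < c.1 → (r, c.2) ∉ P) ∧
  (∀ k, 0 < k → k < c.2 → (c.1, k) ∉ P)


/-- A more usable list of the axioms of a tree-like tableau. -/
structure TL (D P : Finset (ℕ × ℕ)) : Prop where
  young : ∀ i j i' j', (i, j) ∈ D → i' ≤ i → j' ≤ j → (i', j') ∈ D
  sub : ∀ x y, (x, y) ∈ P → (x, y) ∈ D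
  root : (0, 0) ∈ P
  nb : ∀ x y r k, (x, y) ∈ P → r < x → (r, y) ∈ P → k < y → (x, k) ∈ P → False
  some : ∀ x y, (x, y) ∈ P → (x ≠ 0 ∨ y ≠ 0) → (∃ r < x, (r, y) ∈ P) ∨ (∃ k < y, (x, k) ∈ P)
  row : ∀ x y, (x, y) ∈ D → ∃ k, (x, k) ∈ P
  col : ∀ x y, (x, y) ∈ D → ∃ r, (r, y) ∈ P

theorem isTLT_iff (D P : Finset (ℕ × ℕ)) : IsTLT D P ↔ TL D P := by
  constructor
  · rintro ⟨h1, h2, h3, h4, h5⟩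
    refine ⟨h1, fun x y h => h2 h, h3, ?_, ?_, fun x y h => (h5 _ h).1, fun x y h => (h5 _ h).2⟩
    · intro x y r k h hr hrp hk hkp
      have := (h4 (x, y) h (by intro e; simp at e; omega)).1 ⟨r, hr, hrp⟩
      exact this ⟨k, hk, hkp⟩
    · intro x y h hne
      have := h4 (x, y) h (by intro e; simp at e; omega)
      simp only at this
      rw [this]
      exact (em _).symm
  · intro h
    refine ⟨h.young, fun c hc => h.sub c.1 c.2 hc, h.root, ?_, fun c hc => ⟨h.row c.1 c.2 hc, h.col c.1 c.2 hc⟩⟩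
    rintro ⟨x, y⟩ hc hne
    constructor
    · rintro ⟨r, hr, hrp⟩ ⟨k, hk, hkp⟩
      exact h.nb x y r k hc hr hrp hk hkp
    · intro hn
      have := h.some x y hc (by by_contra hh; push Not at hh; exact hne (by simp [hh.1, hh.2]))
      exact this.resolve_right hn

theorem mem_TLTs (n : ℕ) (T : Finset (ℕ × ℕ) × Finset (ℕ × ℕ)) :
    T ∈ TLTs n ↔ TL T.1 T.2 ∧ T.2.card = n := by
  classical
  unfold TLTs
  simp only [Finset.mem_filter, Finset.mem_product, Finset.mem_powerset, isTLT_iff]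
  constructor
  · exact fun h => h.2
  · rintro ⟨h, hc⟩
    have hD : T.1 ⊆ Finset.range (n + 1) ×ˢ Finset.range (n + 1) := by
      rintro ⟨x, y⟩ hxy
      have hx : Finset.range (x + 1) ⊆ T.2.image Prod.fst := by
        intro i hi
        obtain ⟨k, hk⟩ := h.row i y (h.young x y i y hxy (by simp at hi; omega) le_rfl)
        exact Finset.mem_image.2 ⟨_, hk, rfl⟩
      have hy : Finset.range (y + 1) ⊆ T.2.image Prod.snd := by
        intro i hi
        obtain ⟨k, hk⟩ := h.col x i (h.young x y x i hxy le_rfl (by simp at hi; omega))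
        exact Finset.mem_image.2 ⟨_, hk, rfl⟩
      have hx' := (Finset.card_le_card hx).trans Finset.card_image_le
      have hy' := (Finset.card_le_card hy).trans Finset.card_image_le
      simp at hx' hy' ⊢
      omega
    exact ⟨⟨hD, fun c hc => hD (h.sub c.1 c.2 hc)⟩, h, hc⟩

/-- down-closed finsets of naturals are initial segments -/
theorem down_closed_mem (S : Finset ℕ) (h : ∀ x ∈ S, ∀ y ≤ x, y ∈ S) (x : ℕ) :
    x ∈ S ↔ x < S.card := by
  constructor
  · intro hx
    have : Finset.range (x + 1) ⊆ S := fun i hi => h x hx i (by simp at hi; omega)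
    have := Finset.card_le_card this
    simp at this; omega
  · intro hx
    by_contra hn
    have : S ⊆ Finset.range x := by
      intro i hi
      simp only [Finset.mem_range]
      by_contra hc
      exact hn (h i hi x (by omega))
    have := Finset.card_le_card this
    simp at this; omega

/-- number of rows -/
def ht (D : Finset (ℕ × ℕ)) : ℕ := (D.filter (fun c => c.2 = 0)).card

theorem mem_ht {D P : Finset (ℕ × ℕ)} (h : TL D P) (x : ℕ) : (x, 0) ∈ D ↔ x < ht D := by
  have hcard : ((D.filter (fun c => c.2 = 0)).image Prod.fst).card = ht D := by
    apply Finset.card_image_of_injOn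
    rintro ⟨a, b⟩ h1 ⟨c, d⟩ h2 h3
    simp at h1 h2 h3 ⊢
    omega
  rw [← hcard, ← down_closed_mem]
  · simp
  · intro x hx y hy
    simp at hx ⊢
    exact h.young _ _ _ _ hx hy le_rfl

/-- all rows have length at least two -/
def Full (D : Finset (ℕ × ℕ)) : Prop := ∀ x, (x, 0) ∈ D → (x, 1) ∈ D

/-- Type A: last row of length one. -/
theorem typeA (D P : Finset (ℕ × ℕ)) (h : TL D P) (hP : 2 ≤ P.card) (hF : ¬ Full D) :
    2 ≤ ht D ∧ (∀ y, (ht D - 1, y) ∈ D → y = 0) ∧ (ht D - 1, 0) ∈ P := by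
  have h0 : (0, 0) ∈ D := h.sub _ _ h.root
  have hh : 0 < ht D := (mem_ht h 0).1 h0
  unfold Full at hF
  push Not at hF
  obtain ⟨x, hx, hx1⟩ := hF
  have hl : ∀ y, (ht D - 1, y) ∈ D → y = 0 := by
    intro y hy
    by_contra hne
    exact hx1 (h.young _ _ x 1 hy (by have := (mem_ht h x).1 hx; omega) (by omega))
  have hm : (ht D - 1, 0) ∈ D := (mem_ht h _).2 (by omega)
  obtain ⟨k, hk⟩ := h.row _ _ hm
  have hk0 := hl k (h.sub _ _ hk)
  subst hk0
  refine ⟨?_, hl, hk⟩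
  by_contra hlt
  have h1 : ht D = 1 := by omega
  rw [h1] at hl
  have : P ⊆ {(0, 0)} := by
    rintro ⟨u, v⟩ huv
    have hd := h.sub _ _ huv
    have hu : u = 0 := by
      have := (mem_ht h u).1 (h.young _ _ u 0 hd le_rfl (by omega)); omega
    subst hu
    have := hl v hd
    simp [this]
  have := Finset.card_le_card this
  simp at this; omega

theorem delA_TL (D P : Finset (ℕ × ℕ)) (h : TL D P) (hP : 2 ≤ P.card) (hF : ¬ Full D) :
    TL (D.erase (ht D - 1, 0)) (P.erase (ht D - 1, 0)) := by
  obtain ⟨h2, hl, hm⟩ := typeA D P h hP hF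
  have hmm := mem_ht h
  have hle : ∀ x y, (x, y) ∈ D → x < ht D := fun x y hxy =>
    (hmm x).1 (h.young _ _ x 0 hxy le_rfl (by omega))
  refine ⟨?_, ?_, ?_, ?_, ?_, ?_, ?_⟩ <;> simp only [Finset.mem_erase, ne_eq, Prod.mk.injEq]
  · intro i j i' j' hij hi hj
    refine ⟨?_, h.young _ _ _ _ hij.2 hi hj⟩
    rintro ⟨rfl, rfl⟩
    have := hle _ _ hij.2
    have : i = ht D - 1 := by omega
    subst this
    exact hij.1 ⟨rfl, hl _ hij.2⟩
  · exact fun x y hxy => ⟨hxy.1, h.sub _ _ hxy.2⟩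
  · exact ⟨by omega, h.root⟩
  · exact fun x y r k h1 h2 h3 h4 h5 => h.nb x y r k h1.2 h2 h3.2 h4 h5.2
  · intro x y hxy hne
    have hx := hle _ _ (h.sub _ _ hxy.2)
    rcases h.some x y hxy.2 hne with ⟨r, hr, hrp⟩ | ⟨k, hk, hkp⟩
    · left; exact ⟨r, hr, by omega, hrp⟩
    · right
      refine ⟨k, hk, ?_, hkp⟩
      rintro ⟨rfl, rfl⟩
      exact hxy.1 ⟨rfl, hl _ (h.sub _ _ hxy.2)⟩
  · rintro x y ⟨h1, h3⟩
    obtain ⟨k, hk⟩ := h.row _ _ h3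
    refine ⟨k, ?_, hk⟩
    rintro ⟨rfl, rfl⟩
    exact h1 ⟨rfl, hl _ h3⟩
  · rintro x y ⟨h1, h3⟩
    by_cases hy : y = 0
    · subst hy; exact ⟨0, by omega, h.root⟩
    · obtain ⟨k, hk⟩ := h.col _ _ h3
      exact ⟨k, by omega, hk⟩

theorem insA_TL (D P : Finset (ℕ × ℕ)) (h : TL D P) :
    TL (insert (ht D, 0) D) (insert (ht D, 0) P) := by
  have hmm := mem_ht h
  have hpos : 0 < ht D := (hmm 0).1 (h.sub _ _ h.root)
  have hle : ∀ x y, (x, y) ∈ D → x < ht D := fun x y hxy =>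
    (hmm x).1 (h.young _ _ x 0 hxy le_rfl (by omega))
  have hlp : ∀ x y, (x, y) ∈ P → x < ht D := fun x y hxy => hle _ _ (h.sub _ _ hxy)
  refine ⟨?_, ?_, ?_, ?_, ?_, ?_, ?_⟩ <;> simp only [Finset.mem_insert, Prod.mk.injEq]
  · rintro i j i' j' (⟨rfl, rfl⟩ | hij) hi hj
    · by_cases hh : i' = ht D
      · left; omega
      · right
        have : j' = 0 := by omega
        subst this
        exact (hmm i').2 (by omega)
    · right; exact h.young _ _ _ _ hij hi hj
  · rintro x y (h1 | h1)
    · exact Or.inl h1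
    · exact Or.inr (h.sub _ _ h1)
  · exact Or.inr h.root
  · rintro x y r k (⟨rfl, rfl⟩ | h1) h2 h3 h4 h5
    · omega
    · have := hlp _ _ h1
      exact h.nb x y r k h1 h2 (by rcases h3 with h3 | h3; omega; exact h3) h4
        (by rcases h5 with h5 | h5; omega; exact h5)
  · rintro x y (⟨rfl, rfl⟩ | h1) hne
    · left; exact ⟨0, hpos, Or.inr h.root⟩
    · rcases h.some x y h1 hne with ⟨r, hr, hrp⟩ | ⟨k, hk, hkp⟩
      · left; exact ⟨r, hr, Or.inr hrp⟩
      · right; exact ⟨k, hk, Or.inr hkp⟩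
  · rintro x y (⟨rfl, rfl⟩ | h1)
    · exact ⟨0, by simp⟩
    · obtain ⟨k, hk⟩ := h.row _ _ h1; exact ⟨k, Or.inr hk⟩
  · rintro x y (⟨rfl, rfl⟩ | h1)
    · exact ⟨0, Or.inr h.root⟩
    · obtain ⟨k, hk⟩ := h.col _ _ h1; exact ⟨k, Or.inr hk⟩

theorem ht_insA (D P : Finset (ℕ × ℕ)) (h : TL D P) : ht (insert (ht D, 0) D) = ht D + 1 := by
  have hn : (ht D, 0) ∉ D := by rw [mem_ht h]; omega
  generalize hk : ht D = k at hn ⊢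
  unfold ht at hk ⊢
  rw [Finset.filter_insert, if_pos rfl, Finset.card_insert_of_notMem (by simp [hn]), hk]

theorem ht_delA (D : Finset (ℕ × ℕ)) (hm : (ht D - 1, 0) ∈ D) :
    ht (D.erase (ht D - 1, 0)) = ht D - 1 := by
  generalize hk : ht D = k at hm ⊢
  unfold ht at hk ⊢
  rw [Finset.filter_erase, Finset.card_erase_of_mem (by simp [hm]), hk]

open scoped Classical in
theorem sumA (m : ℕ) (hm : 1 ≤ m) (a b : ℚ) :
    ∑ T ∈ (TLTs (m + 1)).filter (fun T => ¬ Full T.1), a ^ topStat T.2 * b ^ leftStat T.2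
    = b * ∑ T ∈ TLTs m, a ^ topStat T.2 * b ^ leftStat T.2 := by
  rw [Finset.mul_sum]
  symm
  refine Finset.sum_nbij' (fun T => (insert (ht T.1, 0) T.1, insert (ht T.1, 0) T.2))
    (fun T => (T.1.erase (ht T.1 - 1, 0), T.2.erase (ht T.1 - 1, 0))) ?_ ?_ ?_ ?_ ?_
  · rintro ⟨D, P⟩ hT
    rw [mem_TLTs] at hT
    obtain ⟨h, hc⟩ := hT
    simp only at h hc
    have hD : (ht D, 0) ∉ D := by rw [mem_ht h]; omega
    have hP : (ht D, 0) ∉ P := fun hh => hD (h.sub _ _ hh)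
    rw [Finset.mem_filter, mem_TLTs]
    refine ⟨⟨insA_TL D P h, ?_⟩, ?_⟩
    · simp only [Finset.card_insert_of_notMem hP, hc]
    · intro hF
      have := hF (ht D) (by simp)
      simp at this
      exact hD (h.young _ _ _ _ this le_rfl (by omega))
  · rintro ⟨D, P⟩ hT
    rw [Finset.mem_filter, mem_TLTs] at hT
    obtain ⟨⟨h, hc⟩, hF⟩ := hT
    rw [mem_TLTs]
    simp only at hc hF h
    refine ⟨delA_TL D P h (by omega) hF, ?_⟩
    simp only [Finset.card_erase_of_mem (typeA D P h (by omega) hF).2.2, hc]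
    omega
  · rintro ⟨D, P⟩ hT
    rw [mem_TLTs] at hT
    obtain ⟨h, hc⟩ := hT
    simp only at h hc
    have hD : (ht D, 0) ∉ D := by rw [mem_ht h]; omega
    have hP : (ht D, 0) ∉ P := fun hh => hD (h.sub _ _ hh)
    simp only [ht_insA D P h, Nat.add_sub_cancel, Finset.erase_insert hD, Finset.erase_insert hP]
  · rintro ⟨D, P⟩ hT
    rw [Finset.mem_filter, mem_TLTs] at hT
    obtain ⟨⟨h, hc⟩, hF⟩ := hT
    simp only at hc hF h
    have hA := typeA D P h (by omega) hF
    simp only [ht_delA D (h.sub _ _ hA.2.2), Finset.insert_erase hA.2.2,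
      Finset.insert_erase (h.sub _ _ hA.2.2)]
  · rintro ⟨D, P⟩ hT
    rw [mem_TLTs] at hT
    obtain ⟨h, hc⟩ := hT
    simp only at h hc
    have hD : (ht D, 0) ∉ D := by rw [mem_ht h]; omega
    have hP : (ht D, 0) ∉ P := fun hh => hD (h.sub _ _ hh)
    have hpos : ht D ≠ 0 := by have := (mem_ht h 0).1 (h.sub _ _ h.root); omega
    have e1 : topStat (insert (ht D, 0) P) = topStat P := by
      unfold topStat
      rw [Finset.filter_insert, if_neg (by simp [hpos])]
    have e2 : leftStat (insert (ht D, 0) P) = leftStat P + 1 := by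
      unfold leftStat
      rw [Finset.filter_insert, if_pos (by simp [hpos]),
        Finset.card_insert_of_notMem (by simp [hP])]
    simp only [e1, e2]
    ring

/-- insert a full column in position one -/
def insD (D : Finset (ℕ × ℕ)) : Finset (ℕ × ℕ) :=
  D.image (fun c => (c.1, if c.2 = 0 then 0 else c.2 + 1)) ∪
    (D.filter (fun c => c.2 = 0)).image (fun c => (c.1, 1))

def phiU (U : Finset ℕ) (c : ℕ × ℕ) : ℕ × ℕ :=
  (c.1, if c.2 = 0 then (if c.1 ∈ U then 1 else 0) else c.2 + 1)

def insP (P : Finset (ℕ × ℕ)) (U : Finset ℕ) : Finset (ℕ × ℕ) :=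
  insert (0, 1) (P.image (phiU U))

def delC (S : Finset (ℕ × ℕ)) : Finset (ℕ × ℕ) := S.image (fun c => (c.1, c.2 - 1))

def colU (P : Finset (ℕ × ℕ)) : Finset ℕ :=
  (P.filter (fun c => c.2 = 1 ∧ c.1 ≠ 0)).image Prod.fst

def freeRows (P : Finset (ℕ × ℕ)) : Finset ℕ :=
  (P.filter (fun c => c.2 = 0 ∧ c ≠ (0, 0))).image Prod.fst

theorem mem_colU (P : Finset (ℕ × ℕ)) (x : ℕ) : x ∈ colU P ↔ (x, 1) ∈ P ∧ x ≠ 0 := by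
  simp [colU]

theorem mem_freeRows (P : Finset (ℕ × ℕ)) (x : ℕ) : x ∈ freeRows P ↔ (x, 0) ∈ P ∧ x ≠ 0 := by
  simp [freeRows]

theorem card_freeRows (P : Finset (ℕ × ℕ)) : (freeRows P).card = leftStat P := by
  unfold freeRows leftStat
  apply Finset.card_image_of_injOn
  rintro ⟨a, b⟩ h1 ⟨c, d⟩ h2 h3
  simp at h1 h2 h3 ⊢
  omega

theorem mem_insD (D : Finset (ℕ × ℕ)) (x y : ℕ) : (x, y) ∈ insD D ↔ (x, y - 1) ∈ D := by
  simp only [insD, Finset.mem_union, Finset.mem_image, Finset.mem_filter, Prod.exists,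
    Prod.mk.injEq]
  constructor
  · rintro (⟨u, v, h, rfl, rfl⟩ | ⟨u, v, ⟨h, rfl⟩, rfl, rfl⟩)
    · split_ifs with hv
      · subst hv; exact h
      · exact h
    · exact h
  · intro h
    rcases y with _ | _ | y
    · exact Or.inl ⟨x, 0, h, rfl, rfl⟩
    · exact Or.inr ⟨x, 0, ⟨h, rfl⟩, rfl, rfl⟩
    · exact Or.inl ⟨x, y + 1, h, rfl, rfl⟩

theorem mem_insP0 (P : Finset (ℕ × ℕ)) (U : Finset ℕ) (x : ℕ) :
    (x, 0) ∈ insP P U ↔ (x, 0) ∈ P ∧ x ∉ U := by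
  simp only [insP, phiU, Finset.mem_insert, Finset.mem_image, Prod.exists, Prod.mk.injEq]
  constructor
  · rintro (h | ⟨u, v, h, rfl, h2⟩)
    · omega
    · split_ifs at h2 with hv hu
      · subst hv; exact ⟨h, hu⟩
  · rintro ⟨h, hU⟩
    exact Or.inr ⟨x, 0, h, rfl, by simp [hU]⟩

theorem mem_insP1 (P : Finset (ℕ × ℕ)) (U : Finset ℕ) (hU : U ⊆ freeRows P) (x : ℕ) :
    (x, 1) ∈ insP P U ↔ x = 0 ∨ x ∈ U := by
  simp only [insP, phiU, Finset.mem_insert, Finset.mem_image, Prod.exists, Prod.mk.injEq, and_true]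
  constructor
  · rintro (h | ⟨u, v, h, rfl, h2⟩)
    · exact Or.inl h
    · split_ifs at h2 with hv hu
      · exact Or.inr hu
      · omega
  · rintro (h | h)
    · exact Or.inl h
    · exact Or.inr ⟨x, 0, ((mem_freeRows _ _).1 (hU h)).1, rfl, by simp [h]⟩

theorem mem_insP2 (P : Finset (ℕ × ℕ)) (U : Finset ℕ) (x y : ℕ) :
    (x, y + 2) ∈ insP P U ↔ (x, y + 1) ∈ P := by
  simp only [insP, phiU, Finset.mem_insert, Finset.mem_image, Prod.exists, Prod.mk.injEq]
  constructor
  · rintro (h | ⟨u, v, h, rfl, h2⟩)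
    · omega
    · have : v = y + 1 := by
        by_cases hv : v = 0
        · rw [if_pos hv] at h2
          split_ifs at h2; omega
        · rw [if_neg hv] at h2
          omega
      subst this
      exact h
  · intro h
    exact Or.inr ⟨x, y + 1, h, rfl, by simp⟩

theorem mem_delC0 (S : Finset (ℕ × ℕ)) (x : ℕ) :
    (x, 0) ∈ delC S ↔ (x, 0) ∈ S ∨ (x, 1) ∈ S := by
  simp only [delC, Finset.mem_image, Prod.exists, Prod.mk.injEq]
  constructor
  · rintro ⟨u, v, h, rfl, h2⟩
    have : v = 0 ∨ v = 1 := by omega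
    rcases this with rfl | rfl
    · exact Or.inl h
    · exact Or.inr h
  · rintro (h | h)
    · exact ⟨_, _, h, rfl, rfl⟩
    · exact ⟨_, _, h, rfl, rfl⟩

theorem mem_delC1 (S : Finset (ℕ × ℕ)) (x y : ℕ) :
    (x, y + 1) ∈ delC S ↔ (x, y + 2) ∈ S := by
  simp only [delC, Finset.mem_image, Prod.exists, Prod.mk.injEq]
  constructor
  · rintro ⟨u, v, h, rfl, h2⟩
    have : v = y + 2 := by omega
    subst this
    exact h
  · intro h
    exact ⟨_, _, h, rfl, rfl⟩

theorem insB_TL (D P : Finset (ℕ × ℕ)) (U : Finset ℕ) (h : TL D P) (hU : U ⊆ freeRows P) :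
    TL (insD D) (insP P U) := by
  have i0 := mem_insP0 P U
  have i1 := mem_insP1 P U hU
  have i2 := mem_insP2 P U
  have hU' : ∀ x ∈ U, (x, 0) ∈ P ∧ x ≠ 0 := fun x hx => (mem_freeRows _ _).1 (hU hx)
  have h0U : 0 ∉ U := fun hh => (hU' 0 hh).2 rfl
  refine ⟨?_, ?_, ?_, ?_, ?_, ?_, ?_⟩
  · intro i j i' j'
    simp only [mem_insD]
    exact fun h1 h2 h3 => h.young _ _ _ _ h1 h2 (by omega)
  · intro x y hxy
    rw [mem_insD]
    rcases y with _ | _ | y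
    · exact h.sub _ _ ((i0 x).1 hxy).1
    · rcases (i1 x).1 hxy with rfl | h1
      · exact h.sub _ _ h.root
      · exact h.sub _ _ (hU' _ h1).1
    · exact h.sub _ _ ((i2 x y).1 hxy)
  · exact (i0 0).2 ⟨h.root, h0U⟩
  · intro x y r k hxy hr hry hk hxk
    rcases y with _ | _ | y
    · omega
    · have : k = 0 := by omega
      subst this
      rcases (i1 x).1 hxy with rfl | h1
      · omega
      · exact ((i0 x).1 hxk).2 h1
    · have hxy' := (i2 x y).1 hxy
      have hry' := (i2 r y).1 hry
      rcases k with _ | _ | k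
      · exact h.nb _ _ r 0 hxy' hr hry' (by omega) ((i0 x).1 hxk).1
      · rcases (i1 x).1 hxk with rfl | h1
        · omega
        · exact h.nb _ _ r 0 hxy' hr hry' (by omega) (hU' _ h1).1
      · exact h.nb _ _ r (k + 1) hxy' hr hry' (by omega) ((i2 x k).1 hxk)
  · intro x y hxy hne
    rcases y with _ | _ | y
    · left
      exact ⟨0, by omega, (i0 0).2 ⟨h.root, h0U⟩⟩
    · by_cases hx : x = 0
      · subst hx
        right
        exact ⟨0, by omega, (i0 0).2 ⟨h.root, h0U⟩⟩
      · left
        exact ⟨0, by omega, (i1 0).2 (Or.inl rfl)⟩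
    · have hxy' := (i2 x y).1 hxy
      rcases h.some _ _ hxy' (by omega) with ⟨r, hr, hrp⟩ | ⟨k, hk, hkp⟩
      · left; exact ⟨r, hr, (i2 r y).2 hrp⟩
      · right
        rcases k with _ | k
        · by_cases hx : x ∈ U
          · exact ⟨1, by omega, (i1 x).2 (Or.inr hx)⟩
          · exact ⟨0, by omega, (i0 x).2 ⟨hkp, hx⟩⟩
        · exact ⟨k + 2, by omega, (i2 x k).2 hkp⟩
  · intro x y hxy
    rw [mem_insD] at hxy
    obtain ⟨k, hk⟩ := h.row _ _ hxy
    rcases k with _ | k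
    · by_cases hx : x ∈ U
      · exact ⟨1, (i1 x).2 (Or.inr hx)⟩
      · exact ⟨0, (i0 x).2 ⟨hk, hx⟩⟩
    · exact ⟨k + 2, (i2 x k).2 hk⟩
  · intro x y hxy
    rw [mem_insD] at hxy
    rcases y with _ | _ | y
    · exact ⟨0, (i0 0).2 ⟨h.root, h0U⟩⟩
    · exact ⟨0, (i1 0).2 (Or.inl rfl)⟩
    · obtain ⟨r, hr⟩ := h.col _ _ hxy
      exact ⟨r, (i2 r y).2 hr⟩

theorem delB_TL (D P : Finset (ℕ × ℕ)) (h : TL D P) (hF : Full D) :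
    TL (delC D) (delC P) := by
  have p0 := mem_delC0 P
  have p1 := mem_delC1 P
  have d0 : ∀ x, (x, 0) ∈ delC D ↔ (x, 0) ∈ D := by
    intro x
    rw [mem_delC0]
    exact ⟨fun hh => hh.elim id (fun hh => h.young _ _ _ _ hh le_rfl (by omega)), Or.inl⟩
  have d1 := mem_delC1 D
  have dd : ∀ x y, (x, y) ∈ delC D ↔ (x, y + 1) ∈ D := by
    intro x y
    rcases y with _ | y
    · rw [d0]
      exact ⟨fun hh => hF _ hh, fun hh => h.young _ _ _ _ hh le_rfl (by omega)⟩
    · exact d1 x y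
  refine ⟨?_, ?_, ?_, ?_, ?_, ?_, ?_⟩
  · intro i j i' j'
    simp only [dd]
    exact fun h1 h2 h3 => h.young _ _ _ _ h1 h2 (by omega)
  · intro x y hxy
    rcases y with _ | y
    · rw [d0]
      rcases (p0 x).1 hxy with h1 | h1
      · exact h.sub _ _ h1
      · exact h.young _ _ _ _ (h.sub _ _ h1) le_rfl (by omega)
    · exact (d1 x y).2 (h.sub _ _ ((p1 x y).1 hxy))
  · exact (p0 0).2 (Or.inl h.root)
  · intro x y r k hxy hr hry hk hxk
    rcases y with _ | y
    · omega
    · have hxy' := (p1 x y).1 hxy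
      have hry' := (p1 r y).1 hry
      rcases k with _ | k
      · rcases (p0 x).1 hxk with h1 | h1
        · exact h.nb _ _ r 0 hxy' hr hry' (by omega) h1
        · exact h.nb _ _ r 1 hxy' hr hry' (by omega) h1
      · exact h.nb _ _ r (k + 2) hxy' hr hry' (by omega) ((p1 x k).1 hxk)
  · intro x y hxy hne
    rcases y with _ | y
    · left
      exact ⟨0, by omega, (p0 0).2 (Or.inl h.root)⟩
    · have hxy' := (p1 x y).1 hxy
      rcases h.some _ _ hxy' (by omega) with ⟨r, hr, hrp⟩ | ⟨k, hk, hkp⟩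
      · left; exact ⟨r, hr, (p1 r y).2 hrp⟩
      · right
        rcases k with _ | _ | k
        · exact ⟨0, by omega, (p0 x).2 (Or.inl hkp)⟩
        · exact ⟨0, by omega, (p0 x).2 (Or.inr hkp)⟩
        · exact ⟨k + 1, by omega, (p1 x k).2 hkp⟩
  · intro x y hxy
    rw [dd] at hxy
    obtain ⟨k, hk⟩ := h.row _ _ hxy
    rcases k with _ | _ | k
    · exact ⟨0, (p0 x).2 (Or.inl hk)⟩
    · exact ⟨0, (p0 x).2 (Or.inr hk)⟩
    · exact ⟨k + 1, (p1 x k).2 hk⟩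
  · intro x y hxy
    rw [dd] at hxy
    rcases y with _ | y
    · exact ⟨0, (p0 0).2 (Or.inl h.root)⟩
    · obtain ⟨r, hr⟩ := h.col _ _ hxy
      exact ⟨r, (p1 r y).2 hr⟩

theorem phiU_inj (U : Finset ℕ) : Function.Injective (phiU U) := by
  rintro ⟨x, y⟩ ⟨u, v⟩ h
  simp only [phiU, Prod.mk.injEq] at h ⊢
  obtain ⟨rfl, h⟩ := h
  refine ⟨rfl, ?_⟩
  split_ifs at h <;> omega

theorem notMem_phi (P : Finset (ℕ × ℕ)) (U : Finset ℕ) (hU : U ⊆ freeRows P) :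
    (0, 1) ∉ P.image (phiU U) := by
  have h0U : 0 ∉ U := fun hh => ((mem_freeRows _ _).1 (hU hh)).2 rfl
  simp only [Finset.mem_image, Prod.exists, phiU, Prod.mk.injEq, not_exists, not_and]
  rintro u v - rfl
  rw [if_neg h0U]
  by_cases hv : v = 0 <;> simp [hv]

theorem card_insP (P : Finset (ℕ × ℕ)) (U : Finset ℕ) (hU : U ⊆ freeRows P) :
    (insP P U).card = P.card + 1 := by
  unfold insP
  rw [Finset.card_insert_of_notMem (notMem_phi P U hU), Finset.card_image_of_injective _ (phiU_inj U)]

theorem topStat_insP (P : Finset (ℕ × ℕ)) (U : Finset ℕ) (hU : U ⊆ freeRows P) :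
    topStat (insP P U) = topStat P + 1 := by
  have h0U : 0 ∉ U := fun hh => ((mem_freeRows _ _).1 (hU hh)).2 rfl
  unfold insP topStat
  rw [Finset.filter_insert, if_pos (by simp), Finset.card_insert_of_notMem, Finset.filter_image,
    Finset.card_image_of_injective _ (phiU_inj U)]
  · congr 2
    ext ⟨x, y⟩
    simp only [phiU, Finset.mem_filter, ne_eq, Prod.mk.injEq, not_and]
    refine and_congr_right fun _ => and_congr_right fun hx => ?_
    subst hx
    simp only [if_neg h0U]
    by_cases hy : y = 0 <;> simp [hy]
  · intro hh
    exact notMem_phi P U hU (Finset.mem_filter.1 hh).1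

theorem freeRows_insP (P : Finset (ℕ × ℕ)) (U : Finset ℕ) :
    freeRows (insP P U) = freeRows P \ U := by
  ext x
  simp only [mem_freeRows, mem_insP0, Finset.mem_sdiff]
  tauto

theorem leftStat_insP (P : Finset (ℕ × ℕ)) (U : Finset ℕ) (hU : U ⊆ freeRows P) :
    leftStat (insP P U) = leftStat P - U.card := by
  rw [← card_freeRows, freeRows_insP, Finset.card_sdiff_of_subset hU, card_freeRows]

theorem delC_insP (P : Finset (ℕ × ℕ)) (U : Finset ℕ) (hr : (0, 0) ∈ P) (hU : U ⊆ freeRows P) :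
    delC (insP P U) = P := by
  ext ⟨x, y⟩
  rcases y with _ | y
  · rw [mem_delC0, mem_insP0, mem_insP1 _ _ hU]
    constructor
    · rintro (h | rfl | h)
      · exact h.1
      · exact hr
      · exact ((mem_freeRows _ _).1 (hU h)).1
    · intro h
      by_cases hx : x ∈ U
      · tauto
      · tauto
  · rw [mem_delC1, mem_insP2]

theorem colU_insP (P : Finset (ℕ × ℕ)) (U : Finset ℕ) (hU : U ⊆ freeRows P) :
    colU (insP P U) = U := by
  ext x
  rw [mem_colU, mem_insP1 _ _ hU]
  constructor
  · tauto
  · exact fun h => ⟨Or.inr h, ((mem_freeRows _ _).1 (hU h)).2⟩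

theorem delC_insD (D : Finset (ℕ × ℕ)) : delC (insD D) = D := by
  ext ⟨x, y⟩
  rcases y with _ | y
  · rw [mem_delC0, mem_insD, mem_insD]
    simp
  · rw [mem_delC1, mem_insD]; simp

theorem insD_delC (D P : Finset (ℕ × ℕ)) (h : TL D P) (hF : Full D) : insD (delC D) = D := by
  have hy : ∀ x, (x, 1) ∈ D → (x, 0) ∈ D := fun x hx => h.young _ _ _ _ hx le_rfl (by omega)
  ext ⟨x, y⟩
  rw [mem_insD]
  rcases y with _ | _ | y
  · simp only [Nat.zero_sub, mem_delC0]
    exact ⟨fun hh => hh.elim id (hy x), Or.inl⟩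
  · simp only [zero_add, Nat.sub_self, mem_delC0]
    exact ⟨fun hh => hh.elim (hF x) id, Or.inr⟩
  · exact mem_delC1 D x y

theorem colU_sub (P : Finset (ℕ × ℕ)) : colU P ⊆ freeRows (delC P) := by
  intro x hx
  rw [mem_colU] at hx
  rw [mem_freeRows, mem_delC0]
  tauto

theorem insP_delC (D P : Finset (ℕ × ℕ)) (h : TL D P) (h01 : (0, 1) ∈ P) :
    insP (delC P) (colU P) = P := by
  ext ⟨x, y⟩
  rcases y with _ | _ | y
  · rw [mem_insP0, mem_delC0, mem_colU]
    constructor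
    · rintro ⟨h1 | h1, h2⟩
      · exact h1
      · have : x = 0 := by tauto
        subst this
        exact h.root
    · intro h1
      refine ⟨Or.inl h1, ?_⟩
      rintro ⟨h2, h3⟩
      exact h.nb x 1 0 0 h2 (by omega) h01 (by omega) h1
  · rw [zero_add, mem_insP1 _ _ (colU_sub P), mem_colU]
    constructor
    · rintro (rfl | h1)
      · exact h01
      · exact h1.1
    · intro h1
      tauto
  · rw [mem_insP2, mem_delC1]

open scoped Classical in
theorem sumB (m : ℕ) (f : Finset ℕ → ℕ → ℕ → ℚ) :
    ∑ T ∈ (TLTs (m + 1)).filter (fun T => Full T.1 ∧ (0, 1) ∈ T.2),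
      f (colU T.2) (topStat T.2) (leftStat T.2)
    = ∑ T ∈ TLTs m, ∑ U ∈ (freeRows T.2).powerset,
        f U (topStat T.2 + 1) (leftStat T.2 - U.card) := by
  rw [Finset.sum_sigma']
  symm
  refine Finset.sum_nbij' (fun x => (insD x.1.1, insP x.1.2 x.2))
    (fun T => ⟨(delC T.1, delC T.2), colU T.2⟩) ?_ ?_ ?_ ?_ ?_
  · rintro ⟨⟨D, P⟩, U⟩ hT
    rw [Finset.mem_sigma, mem_TLTs, Finset.mem_powerset] at hT
    obtain ⟨⟨h, hc⟩, hU⟩ := hT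
    simp only at h hc hU
    rw [Finset.mem_filter, mem_TLTs]
    refine ⟨⟨insB_TL D P U h hU, ?_⟩, ?_, ?_⟩
    · simp only [card_insP P U hU, hc]
    · intro x
      simp only [mem_insD]
      exact id
    · exact (mem_insP1 P U hU 0).2 (Or.inl rfl)
  · rintro ⟨D, P⟩ hT
    rw [Finset.mem_filter, mem_TLTs] at hT
    obtain ⟨⟨h, hc⟩, hF, h01⟩ := hT
    simp only at h hc hF h01
    rw [Finset.mem_sigma, mem_TLTs, Finset.mem_powerset]
    refine ⟨⟨delB_TL D P h hF, ?_⟩, colU_sub P⟩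
    have := card_insP (delC P) (colU P) (colU_sub P)
    rw [insP_delC D P h h01] at this
    simp only
    omega
  · rintro ⟨⟨D, P⟩, U⟩ hT
    rw [Finset.mem_sigma, mem_TLTs, Finset.mem_powerset] at hT
    obtain ⟨⟨h, hc⟩, hU⟩ := hT
    simp only at h hc hU
    simp only [delC_insD D, delC_insP P U h.root hU, colU_insP P U hU]
  · rintro ⟨D, P⟩ hT
    rw [Finset.mem_filter, mem_TLTs] at hT
    obtain ⟨⟨h, hc⟩, hF, h01⟩ := hT
    simp only at h hc hF h01
    simp only [insD_delC D P h hF, insP_delC D P h h01]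
  · rintro ⟨⟨D, P⟩, U⟩ hT
    rw [Finset.mem_sigma, mem_TLTs, Finset.mem_powerset] at hT
    obtain ⟨⟨h, hc⟩, hU⟩ := hT
    simp only at h hc hU
    simp only [topStat_insP P U hU, leftStat_insP P U hU, colU_insP P U hU]

/-- From type B to type C. -/
noncomputable def toC (P : Finset (ℕ × ℕ)) : Finset (ℕ × ℕ) :=
  insert (sInf (colU P : Set ℕ), 0) (P.erase (0, 1))

/-- From type C to type B. -/
noncomputable def toB (P : Finset (ℕ × ℕ)) : Finset (ℕ × ℕ) :=
  insert (0, 1) (P.erase (sInf (colU P : Set ℕ), 0))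

theorem colU_toC (P : Finset (ℕ × ℕ)) : colU (toC P) = colU P := by
  ext x
  simp only [mem_colU, toC, Finset.mem_insert, Finset.mem_erase, Prod.mk.injEq, ne_eq]
  constructor
  · rintro ⟨h | h, h2⟩
    · omega
    · exact ⟨h.2, h2⟩
  · rintro ⟨h, h2⟩
    exact ⟨Or.inr ⟨by omega, h⟩, h2⟩

theorem colU_toB (P : Finset (ℕ × ℕ)) : colU (toB P) = colU P := by
  ext x
  simp only [mem_colU, toB, Finset.mem_insert, Finset.mem_erase, Prod.mk.injEq, ne_eq]
  constructor
  · rintro ⟨h | h, h2⟩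
    · omega
    · exact ⟨h.2, h2⟩
  · rintro ⟨h, h2⟩
    exact ⟨Or.inr ⟨by omega, h⟩, h2⟩

theorem sInf_spec (P : Finset (ℕ × ℕ)) (hne : (colU P).Nonempty) :
    ((sInf (colU P : Set ℕ), 1) ∈ P ∧ sInf (colU P : Set ℕ) ≠ 0) ∧
      ∀ x, (x, 1) ∈ P → x ≠ 0 → sInf (colU P : Set ℕ) ≤ x := by
  have hm : sInf (colU P : Set ℕ) ∈ colU P := by
    have := Nat.sInf_mem (s := (colU P : Set ℕ)) (by simpa using hne)
    simpa using this
  refine ⟨(mem_colU _ _).1 hm, fun x h1 h2 => Nat.sInf_le ?_⟩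
  simp [mem_colU, h1, h2]

theorem toC_TL (D P : Finset (ℕ × ℕ)) (h : TL D P) (h01 : (0, 1) ∈ P)
    (hne : (colU P).Nonempty) : TL D (toC P) ∧ (sInf (colU P : Set ℕ), 0) ∉ P := by
  obtain ⟨⟨ht1, ht0⟩, hmin⟩ := sInf_spec P hne
  unfold toC
  generalize sInf (colU P : Set ℕ) = t at ht1 ht0 hmin ⊢
  have hn0 : ∀ x, x ≠ 0 → (x, 1) ∈ P → (x, 0) ∉ P := fun x hx h1 h2 =>
    h.nb x 1 0 0 h1 (by omega) h01 (by omega) h2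
  refine ⟨?_, hn0 t ht0 ht1⟩
  have hroot : (0, 0) = (t, 0) ∨ (0, 0) ≠ (0, 1) ∧ (0, 0) ∈ P := Or.inr ⟨by simp, h.root⟩
  refine ⟨h.young, ?_, ?_, ?_, ?_, ?_, ?_⟩ <;>
    simp only [Finset.mem_insert, Finset.mem_erase, Prod.mk.injEq, ne_eq] at hroot ⊢
  · rintro x y (⟨rfl, rfl⟩ | ⟨-, h1⟩)
    · exact h.young _ _ _ _ (h.sub _ _ ht1) le_rfl (by omega)
    · exact h.sub _ _ h1
  · exact hroot
  · rintro x y r k (⟨rfl, rfl⟩ | ⟨h1, h1'⟩) hr hry hk hxk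
    · omega
    · have hry' : (r, y) ∈ P := by
        rcases hry with hry | hry
        · omega
        · exact hry.2
      rcases hxk with ⟨rfl, rfl⟩ | ⟨h2, h2'⟩
      · by_cases hy : y = 1
        · subst hy
          have : r ≠ 0 := by rintro rfl; simp at hry
          have := hmin r hry' this
          omega
        · exact h.nb x y r 1 h1' hr hry' (by omega) ht1
      · exact h.nb x y r k h1' hr hry' hk h2'
  · rintro x y (⟨rfl, rfl⟩ | ⟨h1, h1'⟩) hxy
    · left
      exact ⟨0, by omega, by simpa using hroot⟩
    · by_cases hy : y = 1
      · subst hy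
        have hx : x ≠ 0 := by rintro rfl; simp at h1
        have := hmin x h1' hx
        by_cases hxt : x = t
        · right; exact ⟨0, by omega, Or.inl ⟨hxt, rfl⟩⟩
        · left; exact ⟨t, by omega, Or.inr ⟨by omega, ht1⟩⟩
      · rcases h.some x y h1' hxy with ⟨r, hr, hrp⟩ | ⟨k, hk, hkp⟩
        · left; exact ⟨r, hr, Or.inr ⟨by omega, hrp⟩⟩
        · right
          by_cases hx : x = 0
          · subst hx; exact ⟨0, by omega, by simpa using hroot⟩
          · exact ⟨k, hk, Or.inr ⟨by omega, hkp⟩⟩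
  · intro x y hxy
    by_cases hx : x = 0
    · subst hx; exact ⟨0, by simpa using hroot⟩
    · obtain ⟨k, hk⟩ := h.row _ _ hxy
      exact ⟨k, Or.inr ⟨by omega, hk⟩⟩
  · intro x y hxy
    by_cases hy : y = 1
    · subst hy; exact ⟨t, Or.inr ⟨by omega, ht1⟩⟩
    · obtain ⟨k, hk⟩ := h.col _ _ hxy
      exact ⟨k, Or.inr ⟨by omega, hk⟩⟩

theorem toB_TL (D P : Finset (ℕ × ℕ)) (h : TL D P) (hF : Full D) (h01 : (0, 1) ∉ P) :
    TL D (toB P) ∧ (colU P).Nonempty ∧ (sInf (colU P : Set ℕ), 0) ∈ P := by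
  have hne : (colU P).Nonempty := by
    obtain ⟨r, hr⟩ := h.col 0 1 (hF 0 (h.sub _ _ h.root))
    refine ⟨r, (mem_colU _ _).2 ⟨hr, ?_⟩⟩
    rintro rfl
    exact h01 hr
  obtain ⟨⟨ht1, ht0⟩, hmin⟩ := sInf_spec P hne
  refine (fun (hh : _ ∧ _) => ⟨hh.1, hne, hh.2⟩) ?_
  unfold toB
  generalize sInf (colU P : Set ℕ) = t at ht1 ht0 hmin ⊢
  have htP : (t, 0) ∈ P := by
    rcases h.some t 1 ht1 (by omega) with ⟨r, hr, hrp⟩ | ⟨k, hk, hkp⟩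
    · have hr0 : r ≠ 0 := by rintro rfl; exact h01 hrp
      have := hmin r hrp hr0
      omega
    · have : k = 0 := by omega
      subst this
      exact hkp
  refine ⟨?_, htP⟩
  have hroot : (0, 0) = (0, 1) ∨ (0, 0) ≠ (t, 0) ∧ (0, 0) ∈ P :=
    Or.inr ⟨by simp; omega, h.root⟩
  refine ⟨h.young, ?_, ?_, ?_, ?_, ?_, ?_⟩ <;>
    simp only [Finset.mem_insert, Finset.mem_erase, Prod.mk.injEq, ne_eq] at hroot ⊢
  · rintro x y (⟨rfl, rfl⟩ | ⟨-, h1⟩)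
    · exact hF 0 (h.sub _ _ h.root)
    · exact h.sub _ _ h1
  · exact hroot
  · rintro x y r k (⟨rfl, rfl⟩ | ⟨h1, h1'⟩) hr hry hk hxk
    · omega
    · have hxk' : (x, k) ∈ P := by
        rcases hxk with hxk | hxk
        · omega
        · exact hxk.2
      rcases hry with ⟨rfl, rfl⟩ | ⟨h2, h2'⟩
      · have hk0 : k = 0 := by omega
        subst hk0
        have := hmin x h1' (by omega)
        have hxt : x ≠ t := by
          rintro rfl
          simp at hxk
        exact h.nb x 1 t 0 h1' (by omega) ht1 (by omega) hxk'
      · exact h.nb x y r k h1' hr h2' hk hxk'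
  · rintro x y (⟨rfl, rfl⟩ | ⟨h1, h1'⟩) hxy
    · right
      exact ⟨0, by omega, by simpa using hroot⟩
    · by_cases hy : y = 0
      · subst hy
        left; exact ⟨0, by omega, by simpa using hroot⟩
      · by_cases hy1 : y = 1
        · subst hy1
          left
          refine ⟨0, ?_, Or.inl ⟨rfl, rfl⟩⟩
          rcases Nat.eq_zero_or_pos x with rfl | hx
          · exact absurd h1' h01
          · exact hx
        · rcases h.some x y h1' hxy with ⟨r, hr, hrp⟩ | ⟨k, hk, hkp⟩
          · left; exact ⟨r, hr, Or.inr ⟨by omega, hrp⟩⟩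
          · right
            by_cases hx : x = t
            · subst hx; exact ⟨1, by omega, Or.inr ⟨by omega, ht1⟩⟩
            · exact ⟨k, hk, Or.inr ⟨by omega, hkp⟩⟩
  · intro x y hxy
    by_cases hx : x = t
    · subst hx; exact ⟨1, Or.inr ⟨by omega, ht1⟩⟩
    · obtain ⟨k, hk⟩ := h.row _ _ hxy
      exact ⟨k, Or.inr ⟨by omega, hk⟩⟩
  · intro x y hxy
    by_cases hy : y = 0
    · subst hy; exact ⟨0, by simpa using hroot⟩
    · obtain ⟨k, hk⟩ := h.col _ _ hxy
      exact ⟨k, Or.inr ⟨by omega, hk⟩⟩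

theorem toB_toC (D P : Finset (ℕ × ℕ)) (h : TL D P) (h01 : (0, 1) ∈ P)
    (hne : (colU P).Nonempty) : toB (toC P) = P := by
  have h0 := (toC_TL D P h h01 hne).2
  have hc := colU_toC P
  unfold toB
  rw [hc]
  unfold toC
  rw [Finset.erase_insert (by simp [h0]), Finset.insert_erase h01]

theorem toC_toB (D P : Finset (ℕ × ℕ)) (h : TL D P) (hF : Full D) (h01 : (0, 1) ∉ P) :
    toC (toB P) = P := by
  obtain ⟨-, hne, h0⟩ := toB_TL D P h hF h01
  have hc := colU_toB P
  unfold toC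
  rw [hc]
  unfold toB
  rw [Finset.erase_insert (by simp [h01]), Finset.insert_erase h0]

theorem stats_toB (D P : Finset (ℕ × ℕ)) (h : TL D P) (hF : Full D) (h01 : (0, 1) ∉ P) :
    (toB P).card = P.card ∧ topStat (toB P) = topStat P + 1 ∧
      leftStat P = leftStat (toB P) + 1 := by
  obtain ⟨-, hne, h0⟩ := toB_TL D P h hF h01
  obtain ⟨⟨ht1, ht0⟩, hmin⟩ := sInf_spec P hne
  unfold toB
  generalize sInf (colU P : Set ℕ) = t at ht1 ht0 hmin h0 ⊢
  have hpos : 0 < P.card := Finset.card_pos.2 ⟨_, h0⟩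
  refine ⟨?_, ?_, ?_⟩
  · rw [Finset.card_insert_of_notMem (by simp [h01]), Finset.card_erase_of_mem h0]
    omega
  · unfold topStat
    rw [Finset.filter_insert, if_pos (by simp), Finset.card_insert_of_notMem (by simp [h01]),
      Finset.filter_erase, Finset.erase_eq_of_notMem (by simp [ht0])]
  · unfold leftStat
    rw [Finset.filter_insert, if_neg (by simp), Finset.filter_erase,
      Finset.card_erase_of_mem (by simp [h0, ht0])]
    have : 0 < (P.filter (fun c => c.2 = 0 ∧ c ≠ (0, 0))).card :=
      Finset.card_pos.2 ⟨(t, 0), by simp [h0, ht0]⟩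
    omega

open scoped Classical in
theorem sumC (m : ℕ) (a b : ℚ) :
    ∑ T ∈ (TLTs (m + 1)).filter (fun T => Full T.1 ∧ (0, 1) ∉ T.2),
      a ^ topStat T.2 * b ^ leftStat T.2
    = ∑ T ∈ (TLTs (m + 1)).filter (fun T => Full T.1 ∧ (0, 1) ∈ T.2),
      (if colU T.2 = ∅ then 0 else a ^ (topStat T.2 - 1) * b ^ (leftStat T.2 + 1)) := by
  have e : ∀ T : Finset (ℕ × ℕ) × Finset (ℕ × ℕ),
    (if colU T.2 = ∅ then (0 : ℚ) else a ^ (topStat T.2 - 1) * b ^ (leftStat T.2 + 1)) =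
    (if (colU T.2).Nonempty then a ^ (topStat T.2 - 1) * b ^ (leftStat T.2 + 1) else 0) := by
    intro T
    by_cases hh : colU T.2 = ∅
    · simp [hh]
    · rw [if_neg hh, if_pos (Finset.nonempty_iff_ne_empty.2 hh)]
  simp only [e]
  rw [← Finset.sum_filter]
  refine Finset.sum_nbij' (fun T => (T.1, toB T.2)) (fun T => (T.1, toC T.2)) ?_ ?_ ?_ ?_ ?_
  · rintro ⟨D, P⟩ hT
    rw [Finset.mem_filter, mem_TLTs] at hT
    obtain ⟨⟨h, hc⟩, hF, h01⟩ := hT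
    simp only at h hc hF h01
    rw [Finset.mem_filter, Finset.mem_filter, mem_TLTs]
    have hB := toB_TL D P h hF h01
    refine ⟨⟨⟨hB.1, ?_⟩, hF, ?_⟩, ?_⟩
    · simp only [(stats_toB D P h hF h01).1, hc]
    · simp [toB]
    · simp only [colU_toB]; exact hB.2.1
  · rintro ⟨D, P⟩ hT
    rw [Finset.mem_filter, Finset.mem_filter, mem_TLTs] at hT
    obtain ⟨⟨⟨h, hc⟩, hF, h01⟩, hne⟩ := hT
    simp only at h hc hF h01 hne
    rw [Finset.mem_filter, mem_TLTs]
    have hC := toC_TL D P h h01 hne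
    have hn : (0, 1) ∉ toC P := by simp [toC]
    refine ⟨⟨hC.1, ?_⟩, hF, hn⟩
    have := (stats_toB D (toC P) hC.1 hF hn).1
    rw [toB_toC D P h h01 hne] at this
    simp only
    omega
  · rintro ⟨D, P⟩ hT
    rw [Finset.mem_filter, mem_TLTs] at hT
    obtain ⟨⟨h, hc⟩, hF, h01⟩ := hT
    simp only at h hc hF h01
    simp only [toC_toB D P h hF h01]
  · rintro ⟨D, P⟩ hT
    rw [Finset.mem_filter, Finset.mem_filter, mem_TLTs] at hT
    obtain ⟨⟨⟨h, hc⟩, hF, h01⟩, hne⟩ := hT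
    simp only at h hc hF h01 hne
    simp only [toB_toC D P h h01 hne]
  · rintro ⟨D, P⟩ hT
    rw [Finset.mem_filter, mem_TLTs] at hT
    obtain ⟨⟨h, hc⟩, hF, h01⟩ := hT
    simp only at h hc hF h01
    obtain ⟨-, h1, h2⟩ := stats_toB D P h hF h01
    simp only [h1, h2, Nat.add_sub_cancel]

/-- generating polynomial -/
noncomputable def W (m : ℕ) (a b : ℚ) : ℚ :=
  ∑ T ∈ TLTs m, a ^ topStat T.2 * b ^ leftStat T.2

theorem W_succ (m : ℕ) (hm : 1 ≤ m) (a b : ℚ) : W (m + 1) a b = (a + b) * W m a (b + 1) := by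
  classical
  have hsplit : W (m + 1) a b =
      ∑ T ∈ (TLTs (m + 1)).filter (fun T => ¬ Full T.1), a ^ topStat T.2 * b ^ leftStat T.2 +
      (∑ T ∈ (TLTs (m + 1)).filter (fun T => Full T.1 ∧ (0, 1) ∈ T.2),
        a ^ topStat T.2 * b ^ leftStat T.2 +
      ∑ T ∈ (TLTs (m + 1)).filter (fun T => Full T.1 ∧ (0, 1) ∉ T.2),
        a ^ topStat T.2 * b ^ leftStat T.2) := by
    unfold W
    rw [← Finset.sum_filter_not_add_sum_filter (TLTs (m + 1)) (fun T => Full T.1)]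
    congr 1
    rw [← Finset.sum_filter_add_sum_filter_not
      ((TLTs (m + 1)).filter (fun T => Full T.1)) (fun T => (0, 1) ∈ T.2),
      Finset.filter_filter, Finset.filter_filter]
  rw [hsplit, sumC, sumA m hm, sumB m (fun _ t l => a ^ t * b ^ l),
    sumB m (fun U t l => if U = ∅ then 0 else a ^ (t - 1) * b ^ (l + 1)), Finset.mul_sum,
    ← Finset.sum_add_distrib, ← Finset.sum_add_distrib]
  unfold W
  rw [Finset.mul_sum]
  apply Finset.sum_congr rfl
  rintro ⟨D, P⟩ -
  simp only [Nat.add_sub_cancel]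
  have key : ∑ U ∈ (freeRows P).powerset, b ^ (leftStat P - U.card) = (b + 1) ^ leftStat P := by
    have := Finset.sum_pow_mul_eq_add_pow (1 : ℚ) b (freeRows P)
    simp only [one_pow, one_mul, card_freeRows] at this
    rw [this, add_comm]
  have k1 : ∑ U ∈ (freeRows P).powerset, a ^ (topStat P + 1) * b ^ (leftStat P - U.card)
      = a * (a ^ topStat P * (b + 1) ^ leftStat P) := by
    rw [← Finset.mul_sum, key]; ring
  have k2 : ∑ U ∈ (freeRows P).powerset,
      (if U = ∅ then 0 else a ^ topStat P * b ^ (leftStat P - U.card + 1))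
      = b * (a ^ topStat P * (b + 1) ^ leftStat P) - b * (a ^ topStat P * b ^ leftStat P) := by
    have e : ∀ U : Finset ℕ, (if U = ∅ then 0 else a ^ topStat P * b ^ (leftStat P - U.card + 1))
      = a ^ topStat P * b * b ^ (leftStat P - U.card) -
        (if U = ∅ then b * (a ^ topStat P * b ^ leftStat P) else 0) := by
      intro U
      split_ifs with hU
      · subst hU; simp; ring
      · ring
    simp only [e]
    rw [Finset.sum_sub_distrib, ← Finset.mul_sum, key]
    simp
    ring
  rw [k1, k2]
  ring

theorem W_one (a b : ℚ) : W 1 a b = 1 := by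
  have : TLTs 1 = {({(0, 0)}, {(0, 0)})} := by
    ext ⟨D, P⟩
    rw [mem_TLTs, Finset.mem_singleton]
    simp only [Prod.mk.injEq]
    constructor
    · rintro ⟨h, hc⟩
      obtain ⟨c, rfl⟩ := Finset.card_eq_one.1 hc
      have hr := h.root
      rw [Finset.mem_singleton] at hr
      subst hr
      refine ⟨?_, rfl⟩
      ext ⟨x, y⟩
      constructor
      · intro hxy
        obtain ⟨k, hk⟩ := h.row _ _ hxy
        obtain ⟨r, hr⟩ := h.col _ _ hxy
        simp at hk hr
        simp [hk, hr]
      · intro hxy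
        rw [Finset.mem_singleton] at hxy
        rw [hxy]
        exact h.sub _ _ h.root
    · rintro ⟨rfl, rfl⟩
      refine ⟨⟨?_, ?_, ?_, ?_, ?_, ?_, ?_⟩, rfl⟩ <;> simp <;> omega
  unfold W
  rw [this, Finset.sum_singleton]
  simp [topStat, leftStat, Finset.filter_singleton]

theorem W_eq (m : ℕ) (a b : ℚ) : W (m + 1) a b = ∏ k ∈ Finset.range m, (a + b + k) := by
  induction m generalizing b with
  | zero => simp [W_one]
  | succ m ih =>
    rw [W_succ _ (by omega), ih, Finset.prod_range_succ', mul_comm]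
    congr 1
    · apply Finset.prod_congr rfl
      intro k _
      push_cast
      ring
    · simp

/-- the map skipping `i` -/
def sk (i x : ℕ) : ℕ := if x < i then x else x + 1

theorem sk_spec (i x : ℕ) : (x < i ∧ sk i x = x) ∨ (i ≤ x ∧ sk i x = x + 1) := by
  unfold sk
  split_ifs with h
  · exact Or.inl ⟨h, rfl⟩
  · exact Or.inr ⟨by omega, rfl⟩

theorem sk_cases (i x : ℕ) : x = i ∨ ∃ y, x = sk i y := by
  rcases lt_trichotomy x i with h | h | h
  · exact Or.inr ⟨x, by simp [sk, h]⟩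
  · exact Or.inl h
  · exact Or.inr ⟨x - 1, by have := sk_spec i (x - 1); omega⟩

/-- `(D', P')` is obtained from `(D, P)` by removing row `i` and column `j`. -/
structure Rm (i j : ℕ) (D P D' P' : Finset (ℕ × ℕ)) : Prop where
  hi : 1 ≤ i
  hj : 1 ≤ j
  hD : ∀ x y, (sk i x, sk j y) ∈ D ↔ (x, y) ∈ D'
  hP : ∀ x y, (sk i x, sk j y) ∈ P ↔ (x, y) ∈ P'
  rowD : ∀ y, (i, y) ∈ D ↔ y ≤ j
  colD : ∀ x, (x, j) ∈ D ↔ x ≤ i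
  rowP : ∀ y, (i, y) ∈ P ↔ y = 0
  colP : ∀ x, (x, j) ∈ P ↔ x = 0

theorem Rm.up {i j : ℕ} {D P D' P' : Finset (ℕ × ℕ)} (R : Rm i j D P D' P') (h : TL D' P')
    (h1 : (i - 1, j - 1) ∈ D') (h2 : (i, j) ∉ D') : TL D P := by
  have hi := R.hi
  have hj := R.hj
  have hi0 : sk i 0 = 0 := by have := sk_spec i 0; omega
  have hj0 : sk j 0 = 0 := by have := sk_spec j 0; omega
  have root : (0, 0) ∈ P := by
    have := (R.hP 0 0).2 h.root
    rwa [hi0, hj0] at this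
  refine ⟨?_, ?_, root, ?_, ?_, ?_, ?_⟩
  · intro u v u' v' huv hu hv
    rcases sk_cases i u' with rfl | ⟨x', rfl⟩
    · rw [R.rowD]
      by_contra hlt
      rcases sk_cases u' u with rfl | ⟨x, rfl⟩
      · rw [R.rowD] at huv; omega
      · rcases sk_cases j v with rfl | ⟨y, rfl⟩
        · omega
        · rw [R.hD] at huv
          have := sk_spec u' x
          have := sk_spec j y
          exact h2 (h.young _ _ _ _ huv (by omega) (by omega))
    · rcases sk_cases j v' with rfl | ⟨y', rfl⟩
      · rw [R.colD]
        by_contra hlt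
        rcases sk_cases i u with rfl | ⟨x, rfl⟩
        · omega
        · rcases sk_cases v' v with rfl | ⟨y, rfl⟩
          · rw [R.colD] at huv; omega
          · rw [R.hD] at huv
            have := sk_spec i x
            have := sk_spec v' y
            exact h2 (h.young _ _ _ _ huv (by omega) (by omega))
      · rw [R.hD]
        have := sk_spec i x'
        have := sk_spec j y'
        rcases sk_cases i u with rfl | ⟨x, rfl⟩
        · rw [R.rowD] at huv
          exact h.young _ _ _ _ h1 (by omega) (by omega)
        · rcases sk_cases j v with rfl | ⟨y, rfl⟩
          · rw [R.colD] at huv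
            exact h.young _ _ _ _ h1 (by omega) (by omega)
          · rw [R.hD] at huv
            have := sk_spec i x
            have := sk_spec j y
            exact h.young _ _ _ _ huv (by omega) (by omega)
  · intro u v huv
    rcases sk_cases i u with rfl | ⟨x, rfl⟩
    · rw [R.rowP] at huv; rw [R.rowD]; omega
    · rcases sk_cases j v with rfl | ⟨y, rfl⟩
      · rw [R.colP] at huv; rw [R.colD]; omega
      · rw [R.hP] at huv; rw [R.hD]; exact h.sub _ _ huv
  · intro u v r k huv hr hrv hk huk
    rcases sk_cases i u with rfl | ⟨x, rfl⟩
    · rw [R.rowP] at huv; omega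
    rcases sk_cases j v with rfl | ⟨y, rfl⟩
    · rw [R.colP] at huv; omega
    rcases sk_cases i r with rfl | ⟨r, rfl⟩
    · rw [R.rowP] at hrv; omega
    rcases sk_cases j k with rfl | ⟨k, rfl⟩
    · rw [R.colP] at huk; omega
    rw [R.hP] at huv hrv huk
    have := sk_spec i x
    have := sk_spec j y
    have := sk_spec i r
    have := sk_spec j k
    exact h.nb _ _ _ _ huv (by omega) hrv (by omega) huk
  · intro u v huv hne
    rcases sk_cases i u with rfl | ⟨x, rfl⟩
    · rw [R.rowP] at huv
      subst huv
      exact Or.inl ⟨0, by omega, root⟩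
    rcases sk_cases j v with rfl | ⟨y, rfl⟩
    · rw [R.colP] at huv
      rw [huv]
      exact Or.inr ⟨0, by omega, root⟩
    rw [R.hP] at huv
    have := sk_spec i x
    have := sk_spec j y
    rcases h.some _ _ huv (by omega) with ⟨r, hr, hrp⟩ | ⟨k, hk, hkp⟩
    · have := sk_spec i r
      exact Or.inl ⟨sk i r, by omega, (R.hP _ _).2 hrp⟩
    · have := sk_spec j k
      exact Or.inr ⟨sk j k, by omega, (R.hP _ _).2 hkp⟩
  · intro u v huv
    rcases sk_cases i u with rfl | ⟨x, rfl⟩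
    · exact ⟨0, (R.rowP 0).2 rfl⟩
    rcases sk_cases j v with rfl | ⟨y, rfl⟩
    · rw [R.colD] at huv
      have := sk_spec i x
      obtain ⟨k, hk⟩ := h.row _ _ (h.young _ _ x 0 h1 (by omega) (by omega))
      exact ⟨_, (R.hP _ _).2 hk⟩
    · rw [R.hD] at huv
      obtain ⟨k, hk⟩ := h.row _ _ huv
      exact ⟨_, (R.hP _ _).2 hk⟩
  · intro u v huv
    rcases sk_cases j v with rfl | ⟨y, rfl⟩
    · exact ⟨0, (R.colP 0).2 rfl⟩
    rcases sk_cases i u with rfl | ⟨x, rfl⟩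
    · rw [R.rowD] at huv
      have := sk_spec j y
      obtain ⟨k, hk⟩ := h.col _ _ (h.young _ _ 0 y h1 (by omega) (by omega))
      exact ⟨_, (R.hP _ _).2 hk⟩
    · rw [R.hD] at huv
      obtain ⟨k, hk⟩ := h.col _ _ huv
      exact ⟨_, (R.hP _ _).2 hk⟩

theorem Rm.down {i j : ℕ} {D P D' P' : Finset (ℕ × ℕ)} (R : Rm i j D P D' P') (h : TL D P) :
    TL D' P' ∧ (i - 1, j - 1) ∈ D' ∧ (i, j) ∉ D' := by
  have hi := R.hi
  have hj := R.hj
  have hi0 : sk i 0 = 0 := by have := sk_spec i 0; omega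
  have hj0 : sk j 0 = 0 := by have := sk_spec j 0; omega
  have root : (0, 0) ∈ P' := by
    rw [← R.hP, hi0, hj0]; exact h.root
  refine ⟨⟨?_, ?_, root, ?_, ?_, ?_, ?_⟩, ?_, ?_⟩
  · intro x y x' y' hxy hx hy
    rw [← R.hD] at hxy ⊢
    have := sk_spec i x
    have := sk_spec i x'
    have := sk_spec j y
    have := sk_spec j y'
    exact h.young _ _ _ _ hxy (by omega) (by omega)
  · intro x y hxy
    rw [← R.hD]
    exact h.sub _ _ ((R.hP _ _).2 hxy)
  · intro x y r k hxy hr hry hk hxk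
    rw [← R.hP] at hxy hry hxk
    have := sk_spec i x
    have := sk_spec i r
    have := sk_spec j y
    have := sk_spec j k
    exact h.nb _ _ _ _ hxy (by omega) hry (by omega) hxk
  · intro x y hxy hne
    rw [← R.hP] at hxy
    have := sk_spec i x
    have := sk_spec j y
    rcases h.some _ _ hxy (by omega) with ⟨r, hr, hrp⟩ | ⟨k, hk, hkp⟩
    · left
      rcases sk_cases i r with rfl | ⟨r, rfl⟩
      · rw [R.rowP] at hrp
        have : y = 0 := by omega
        subst this
        exact ⟨0, by omega, root⟩
      · have := sk_spec i r
        exact ⟨r, by omega, (R.hP _ _).1 hrp⟩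
    · right
      rcases sk_cases j k with rfl | ⟨k, rfl⟩
      · rw [R.colP] at hkp
        have : x = 0 := by omega
        subst this
        exact ⟨0, by omega, root⟩
      · have := sk_spec j k
        exact ⟨k, by omega, (R.hP _ _).1 hkp⟩
  · intro x y hxy
    rw [← R.hD] at hxy
    obtain ⟨k, hk⟩ := h.row _ _ hxy
    rcases sk_cases j k with rfl | ⟨k, rfl⟩
    · rw [R.colP] at hk
      have := sk_spec i x
      have : x = 0 := by omega
      subst this
      exact ⟨0, root⟩
    · exact ⟨k, (R.hP _ _).1 hk⟩
  · intro x y hxy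
    rw [← R.hD] at hxy
    obtain ⟨k, hk⟩ := h.col _ _ hxy
    rcases sk_cases i k with rfl | ⟨k, rfl⟩
    · rw [R.rowP] at hk
      have := sk_spec j y
      have : y = 0 := by omega
      subst this
      exact ⟨0, root⟩
    · exact ⟨k, (R.hP _ _).1 hk⟩
  · rw [← R.hD]
    have := sk_spec i (i - 1)
    have := sk_spec j (j - 1)
    exact h.young _ _ _ _ ((R.rowD j).2 le_rfl) (by omega) (by omega)
  · rw [← R.hD]
    intro hh
    have := sk_spec i i
    have := sk_spec j j
    have := (R.colD (i + 1)).1 (h.young _ _ _ _ hh (by omega) (by omega))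
    omega

theorem Rm.noc {i j : ℕ} {D P D' P' : Finset (ℕ × ℕ)} (R : Rm i j D P D' P') :
    NocAB D P (i, j) := by
  have hi := R.hi
  have hj := R.hj
  refine ⟨⟨?_, ?_, ?_⟩, ?_, ?_, ?_⟩
  · exact (R.rowD j).2 le_rfl
  · intro hh; have := (R.colD _).1 hh; simp at this
  · intro hh; have := (R.rowD _).1 hh; simp at this
  · intro hh; have := (R.rowP _).1 hh; omega
  · intro r hr _ hh; have := (R.colP _).1 hh; omega
  · intro r hr _ hh; have := (R.rowP _).1 hh; omega

def skk (i j : ℕ) (c : ℕ × ℕ) : ℕ × ℕ := (sk i c.1, sk j c.2)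

theorem sk_inj (i : ℕ) : Function.Injective (sk i) := by
  intro x y h
  have := sk_spec i x
  have := sk_spec i y
  omega

theorem skk_inj (i j : ℕ) : Function.Injective (skk i j) := by
  rintro ⟨x, y⟩ ⟨u, v⟩ h
  simp only [skk, Prod.mk.injEq] at h ⊢
  exact ⟨sk_inj i h.1, sk_inj j h.2⟩

theorem sk_ne (i x : ℕ) : sk i x ≠ i := by
  have := sk_spec i x
  omega

theorem row_notMem (i j y : ℕ) (X : Finset (ℕ × ℕ)) : (i, y) ∉ X.image (skk i j) := by
  simp only [Finset.mem_image, skk, Prod.mk.injEq, not_exists, not_and]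
  intro c _ h
  exact absurd h (sk_ne i _)

theorem col_notMem (i j x : ℕ) (X : Finset (ℕ × ℕ)) : (x, j) ∉ X.image (skk i j) := by
  simp only [Finset.mem_image, skk, Prod.mk.injEq, not_exists, not_and]
  intro c _ _ h
  exact absurd h (sk_ne j _)

theorem mem_image_skk (i j x y : ℕ) (X : Finset (ℕ × ℕ)) :
    (sk i x, sk j y) ∈ X.image (skk i j) ↔ (x, y) ∈ X :=
  (skk_inj i j).mem_finset_image (a := (x, y))

def insND (i j : ℕ) (D : Finset (ℕ × ℕ)) : Finset (ℕ × ℕ) :=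
  D.image (skk i j) ∪ ((Finset.range (j + 1)).image (fun y => (i, y)) ∪
    (Finset.range (i + 1)).image (fun x => (x, j)))

def insNP (i j : ℕ) (P : Finset (ℕ × ℕ)) : Finset (ℕ × ℕ) :=
  insert (i, 0) (insert (0, j) (P.image (skk i j)))

noncomputable def delN (i j : ℕ) (X : Finset (ℕ × ℕ)) : Finset (ℕ × ℕ) :=
  X.preimage (skk i j) (skk_inj i j).injOn

theorem mem_delN (i j x y : ℕ) (X : Finset (ℕ × ℕ)) :
    (x, y) ∈ delN i j X ↔ (sk i x, sk j y) ∈ X := by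
  simp [delN, skk]

theorem Rm_ins (i j : ℕ) (hi : 1 ≤ i) (hj : 1 ≤ j) (D P : Finset (ℕ × ℕ)) :
    Rm i j (insND i j D) (insNP i j P) D P := by
  refine ⟨hi, hj, ?_, ?_, ?_, ?_, ?_, ?_⟩
  · intro x y
    unfold insND
    rw [Finset.mem_union, mem_image_skk]
    have := sk_ne i x
    have := sk_ne j y
    constructor
    · rintro (h | h)
      · exact h
      · simp at h
        omega
    · exact Or.inl
  · intro x y
    unfold insNP
    have := sk_ne i x
    have := sk_ne j y
    rw [Finset.mem_insert, Finset.mem_insert, mem_image_skk]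
    simp only [Prod.mk.injEq]
    constructor
    · rintro (h | h | h)
      · omega
      · omega
      · exact h
    · exact fun h => Or.inr (Or.inr h)
  · intro y
    unfold insND
    rw [Finset.mem_union, Finset.mem_union, or_iff_right (row_notMem i j y D)]
    simp only [Finset.mem_image, Finset.mem_range, Prod.mk.injEq]
    constructor
    · rintro (⟨u, hu, h⟩ | ⟨u, hu, h⟩) <;> omega
    · exact fun h => Or.inl ⟨y, by omega, by simp⟩
  · intro x
    unfold insND
    rw [Finset.mem_union, Finset.mem_union, or_iff_right (col_notMem i j x D)]
    simp only [Finset.mem_image, Finset.mem_range, Prod.mk.injEq]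
    constructor
    · rintro (⟨u, hu, h⟩ | ⟨u, hu, h⟩) <;> omega
    · exact fun h => Or.inr ⟨x, by omega, by simp⟩
  · intro y
    unfold insNP
    rw [Finset.mem_insert, Finset.mem_insert, or_iff_left (row_notMem i j y P)]
    simp only [Prod.mk.injEq, true_and, and_true]
    omega
  · intro x
    unfold insNP
    rw [Finset.mem_insert, Finset.mem_insert, or_iff_left (col_notMem i j x P)]
    simp only [Prod.mk.injEq, true_and, and_true]
    omega

theorem Rm_del (i j : ℕ) (D P : Finset (ℕ × ℕ)) (h : TL D P) (hn : NocAB D P (i, j)) :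
    Rm i j D P (delN i j D) (delN i j P) := by
  obtain ⟨⟨c1, c2, c3⟩, n1, n2, n3⟩ := hn
  simp only at c1 c2 c3 n1 n2 n3
  have rowD : ∀ y, (i, y) ∈ D ↔ y ≤ j := by
    intro y
    refine ⟨fun hy => ?_, fun hy => h.young _ _ _ _ c1 le_rfl hy⟩
    by_contra hlt
    exact c3 (h.young _ _ _ _ hy le_rfl (by omega))
  have colD : ∀ x, (x, j) ∈ D ↔ x ≤ i := by
    intro y
    refine ⟨fun hy => ?_, fun hy => h.young _ _ _ _ c1 hy le_rfl⟩
    by_contra hlt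
    exact c2 (h.young _ _ _ _ hy (by omega) le_rfl)
  have rowP1 : ∀ y, (i, y) ∈ P → y = 0 ∧ y < j := by
    intro y hy
    have h1 := (rowD y).1 (h.sub _ _ hy)
    have h2 : y ≠ j := by rintro rfl; exact n1 hy
    have h3 : ¬ 0 < y := fun h3 => n3 y h3 (by omega) hy
    omega
  have colP1 : ∀ x, (x, j) ∈ P → x = 0 ∧ x < i := by
    intro y hy
    have h1 := (colD y).1 (h.sub _ _ hy)
    have h2 : y ≠ i := by rintro rfl; exact n1 hy
    have h3 : ¬ 0 < y := fun h3 => n2 y h3 (by omega) hy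
    omega
  obtain ⟨k, hk⟩ := h.row _ _ c1
  obtain ⟨r, hr⟩ := h.col _ _ c1
  have hk' := rowP1 k hk
  have hr' := colP1 r hr
  obtain ⟨rfl, hk'⟩ := hk'
  obtain ⟨rfl, hr'⟩ := hr'
  refine ⟨by omega, by omega, fun x y => (mem_delN _ _ _ _ _).symm,
    fun x y => (mem_delN _ _ _ _ _).symm, rowD, colD, ?_, ?_⟩
  · exact fun y => ⟨fun hy => (rowP1 y hy).1, fun hy => hy ▸ hk⟩
  · exact fun y => ⟨fun hy => (colP1 y hy).1, fun hy => hy ▸ hr⟩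

theorem Rm.uniq_down {i j : ℕ} {D P D' P' D'' P'' : Finset (ℕ × ℕ)} (R : Rm i j D P D' P')
    (R' : Rm i j D P D'' P'') : D' = D'' ∧ P' = P'' := by
  constructor
  · ext ⟨x, y⟩; rw [← R.hD, ← R'.hD]
  · ext ⟨x, y⟩; rw [← R.hP, ← R'.hP]

theorem Rm.uniq_up {i j : ℕ} {D P D' P' D'' P'' : Finset (ℕ × ℕ)} (R : Rm i j D P D' P')
    (R' : Rm i j D'' P'' D' P') : D = D'' ∧ P = P'' := by
  constructor
  · ext ⟨u, v⟩
    rcases sk_cases i u with rfl | ⟨x, rfl⟩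
    · rw [R.rowD, R'.rowD]
    rcases sk_cases j v with rfl | ⟨y, rfl⟩
    · rw [R.colD, R'.colD]
    rw [R.hD, R'.hD]
  · ext ⟨u, v⟩
    rcases sk_cases i u with rfl | ⟨x, rfl⟩
    · rw [R.rowP, R'.rowP]
    rcases sk_cases j v with rfl | ⟨y, rfl⟩
    · rw [R.colP, R'.colP]
    rw [R.hP, R'.hP]

theorem Rm.stats {i j : ℕ} {D P D' P' : Finset (ℕ × ℕ)} (R : Rm i j D P D' P') :
    P.card = P'.card + 2 ∧ topStat P = topStat P' + 1 ∧ leftStat P = leftStat P' + 1 := by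
  have hi := R.hi
  have hj := R.hj
  have e : P = insNP i j P' := (R.uniq_up (Rm_ins i j hi hj D' P')).2
  subst e
  have hi' : i ≠ 0 := by omega
  have hj' : j ≠ 0 := by omega
  have ei : ∀ x, sk i x = 0 ↔ x = 0 := by intro x; have := sk_spec i x; omega
  have ej : ∀ x, sk j x = 0 ↔ x = 0 := by intro x; have := sk_spec j x; omega
  unfold insNP topStat leftStat
  refine ⟨?_, ?_, ?_⟩
  · rw [Finset.card_insert_of_notMem, Finset.card_insert_of_notMem (col_notMem _ _ _ _),
      Finset.card_image_of_injective _ (skk_inj i j)]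
    rw [Finset.mem_insert, not_or]
    exact ⟨by simp [hi'], row_notMem _ _ _ _⟩
  · rw [Finset.filter_insert, if_neg (by simp [hi']), Finset.filter_insert, if_pos (by simp [hj']),
      Finset.card_insert_of_notMem (fun hh => col_notMem _ _ _ _ (Finset.mem_filter.1 hh).1),
      Finset.filter_image, Finset.card_image_of_injective _ (skk_inj i j)]
    simp only [skk, ne_eq, Prod.ext_iff, ei, ej]
  · rw [Finset.filter_insert, if_pos (by simp [hi']), Finset.filter_insert, if_neg (by simp [hj']),
      Finset.card_insert_of_notMem (fun hh => row_notMem _ _ _ _ (Finset.mem_filter.1 hh).1),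
      Finset.filter_image, Finset.card_image_of_injective _ (skk_inj i j)]
    simp only [skk, ne_eq, Prod.ext_iff, ei, ej]

/-- the rim of a diagram -/
def rim (D : Finset (ℕ × ℕ)) : Finset (ℕ × ℕ) := D.filter (fun c => (c.1 + 1, c.2 + 1) ∉ D)

theorem card_rim_hook (D P : Finset (ℕ × ℕ)) (h : TL D P) :
    (rim D).card = (D.filter (fun c => c.1 = 0 ∨ c.2 = 0)).card := by
  have h1 := Finset.card_filter_add_card_filter_not (s := D) (fun c => (c.1 + 1, c.2 + 1) ∈ D)
  have h2 := Finset.card_filter_add_card_filter_not (s := D) (fun c => c.1 = 0 ∨ c.2 = 0)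
  have h3 : (D.filter (fun c => (c.1 + 1, c.2 + 1) ∈ D)).card
      = (D.filter (fun c => ¬ (c.1 = 0 ∨ c.2 = 0))).card := by
    refine Finset.card_nbij' (fun c => (c.1 + 1, c.2 + 1)) (fun c => (c.1 - 1, c.2 - 1)) ?_ ?_ ?_ ?_
    · rintro ⟨x, y⟩ hc
      simp at hc ⊢
      exact hc.2
    · rintro ⟨x, y⟩ hc
      simp at hc ⊢
      obtain ⟨hc, hx, hy⟩ := hc
      refine ⟨h.young _ _ _ _ hc (by omega) (by omega), ?_⟩
      rwa [Nat.sub_add_cancel (by omega), Nat.sub_add_cancel (by omega)]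
    · rintro ⟨x, y⟩ hc
      simp
    · rintro ⟨x, y⟩ hc
      simp at hc ⊢
      omega
  unfold rim
  omega

open scoped Classical in
theorem card_hook (D P : Finset (ℕ × ℕ)) (h : TL D P) :
    P.card = (D.filter (fun c => c.1 = 0 ∨ c.2 = 0)).card := by
  refine Finset.card_bij
    (fun c _ => if ∃ r < c.1, (r, c.2) ∈ P then (c.1, 0) else (0, c.2)) ?_ ?_ ?_
  · rintro ⟨x, y⟩ hc
    have hd := h.sub _ _ hc
    rw [Finset.mem_filter]
    split_ifs
    · exact ⟨h.young _ _ _ _ hd le_rfl (by omega), by simp⟩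
    · exact ⟨h.young _ _ _ _ hd (by omega) le_rfl, by simp⟩
  · rintro ⟨x, y⟩ hc ⟨u, v⟩ hc' he
    simp only at he
    split_ifs at he with h1 h2 h2
    · simp at he
      subst he
      obtain ⟨r, hr, hrp⟩ := h1
      obtain ⟨r', hr', hrp'⟩ := h2
      have a1 : ¬ v < y := fun hh => h.nb _ _ _ _ hc hr hrp hh hc'
      have a2 : ¬ y < v := fun hh => h.nb _ _ _ _ hc' hr' hrp' hh hc
      simp; omega
    · simp at he
      obtain ⟨r, hr, -⟩ := h1
      omega
    · simp at he
      obtain ⟨r, hr, -⟩ := h2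
      omega
    · simp at he
      subst he
      have a1 : ¬ u < x := fun hh => h1 ⟨u, hh, hc'⟩
      have a2 : ¬ x < u := fun hh => h2 ⟨x, hh, hc⟩
      simp; omega
  · rintro ⟨x, y⟩ hc
    rw [Finset.mem_filter] at hc
    obtain ⟨hd, hxy⟩ := hc
    simp only at hxy
    by_cases hx : x = 0
    · subst hx
      have hex := h.col _ _ hd
      refine ⟨(Nat.find hex, y), Nat.find_spec hex, ?_⟩
      rw [if_neg]
      rintro ⟨r, hr, hrp⟩
      exact Nat.find_min hex hr hrp
    · have : y = 0 := by omega
      subst this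
      have hex := h.row _ _ hd
      refine ⟨(x, Nat.find hex), Nat.find_spec hex, ?_⟩
      rw [if_pos]
      rcases h.some _ _ (Nat.find_spec hex) (Or.inl hx) with h1 | ⟨k, hk, hkp⟩
      · exact h1
      · exact absurd hkp (Nat.find_min hex hk)

open scoped Classical in
theorem sumN (m : ℕ) (a b : ℚ) :
    ∑ T ∈ TLTs (m + 2), ∑ _c ∈ T.1.filter (NocAB T.1 T.2), a ^ topStat T.2 * b ^ leftStat T.2
    = ∑ T ∈ TLTs m, ∑ _c ∈ rim T.1, a * b * (a ^ topStat T.2 * b ^ leftStat T.2) := by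
  rw [Finset.sum_sigma', Finset.sum_sigma']
  refine Finset.sum_nbij'
    (fun x => ⟨(delN x.2.1 x.2.2 x.1.1, delN x.2.1 x.2.2 x.1.2), (x.2.1 - 1, x.2.2 - 1)⟩)
    (fun x => ⟨(insND (x.2.1 + 1) (x.2.2 + 1) x.1.1, insNP (x.2.1 + 1) (x.2.2 + 1) x.1.2),
      (x.2.1 + 1, x.2.2 + 1)⟩) ?_ ?_ ?_ ?_ ?_
  · rintro ⟨⟨D, P⟩, ⟨i, j⟩⟩ hT
    rw [Finset.mem_sigma, mem_TLTs, Finset.mem_filter] at hT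
    obtain ⟨⟨h, hc⟩, -, hn⟩ := hT
    simp only at h hc hn
    have R := Rm_del i j D P h hn
    have hi := R.hi
    have hj := R.hj
    obtain ⟨h', r1, r2⟩ := R.down h
    rw [Finset.mem_sigma, mem_TLTs, rim, Finset.mem_filter]
    refine ⟨⟨h', ?_⟩, r1, ?_⟩
    · have := R.stats.1
      simp only
      omega
    · simp only
      rwa [Nat.sub_add_cancel hi, Nat.sub_add_cancel hj]
  · rintro ⟨⟨D, P⟩, ⟨i, j⟩⟩ hT
    rw [Finset.mem_sigma, mem_TLTs, rim, Finset.mem_filter] at hT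
    obtain ⟨⟨h, hc⟩, r1, r2⟩ := hT
    simp only at h hc r1 r2
    have R := Rm_ins (i + 1) (j + 1) (by omega) (by omega) D P
    rw [Finset.mem_sigma, mem_TLTs, Finset.mem_filter]
    refine ⟨⟨R.up h r1 r2, ?_⟩, R.noc.1.1, R.noc⟩
    have := R.stats.1
    simp only
    omega
  · rintro ⟨⟨D, P⟩, ⟨i, j⟩⟩ hT
    rw [Finset.mem_sigma, mem_TLTs, Finset.mem_filter] at hT
    obtain ⟨⟨h, hc⟩, -, hn⟩ := hT
    simp only at h hc hn
    have R := Rm_del i j D P h hn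
    have hi := R.hi
    have hj := R.hj
    obtain ⟨e1, e2⟩ := (Rm_ins i j hi hj (delN i j D) (delN i j P)).uniq_up R
    simp only [Nat.sub_add_cancel hi, Nat.sub_add_cancel hj, e1, e2]
  · rintro ⟨⟨D, P⟩, ⟨i, j⟩⟩ hT
    rw [Finset.mem_sigma, mem_TLTs, rim, Finset.mem_filter] at hT
    obtain ⟨⟨h, hc⟩, r1, r2⟩ := hT
    simp only at h hc r1 r2
    have R := Rm_ins (i + 1) (j + 1) (by omega) (by omega) D P
    obtain ⟨e1, e2⟩ := (Rm_del _ _ _ _ (R.up h r1 r2) R.noc).uniq_down R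
    simp only [e1, e2, Nat.add_sub_cancel]
  · rintro ⟨⟨D, P⟩, ⟨i, j⟩⟩ hT
    rw [Finset.mem_sigma, mem_TLTs, Finset.mem_filter] at hT
    obtain ⟨⟨h, hc⟩, -, hn⟩ := hT
    simp only at h hc hn
    have R := Rm_del i j D P h hn
    obtain ⟨-, e1, e2⟩ := R.stats
    simp only [e1, e2]
    ring

open scoped Classical in
theorem stmt15 (n : ℕ) (hn : 3 ≤ n) (a b : ℚ) :
    ∑ T ∈ TLTs n,
        ((T.1.filter (NocAB T.1 T.2)).card : ℚ) * a ^ topStat T.2 * b ^ leftStat T.2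
    = ((n : ℚ) - 2) * a * b * ∏ k ∈ Finset.range (n - 3), (a + b + k) := by

  obtain ⟨m, rfl⟩ : ∃ m, n = m + 1 + 2 := ⟨n - 3, by omega⟩
  have e := sumN (m + 1) a b
  simp only [Finset.sum_const, nsmul_eq_mul] at e
  have e' : ∑ T ∈ TLTs (m + 1), ((rim T.1).card : ℚ) * (a * b * (a ^ topStat T.2 * b ^ leftStat T.2))
      = ((m : ℚ) + 1) * a * b * W (m + 1) a b := by
    unfold W
    rw [Finset.mul_sum]
    apply Finset.sum_congr rfl
    intro T hT
    rw [mem_TLTs] at hT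
    rw [card_rim_hook _ _ hT.1, ← card_hook _ _ hT.1, hT.2]
    push_cast
    ring
  rw [e', W_eq] at e
  simp only [mul_assoc] at e ⊢
  rw [e]
  have : m + 1 + 2 - 3 = m := by omega
  rw [this]
  push_cast
  ring
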